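/- Let ξ be a real random variable with law μ, E ξ = 0 and E ξ² = 1, and let 0 < τ ≤ 1/64. There exists a constant C₀'₀ (depending on τ) such that for every C₀' ≥ C₀'₀ the following holds for all sufficiently large n (depending on τ, C₀', μ): if t ∈ [−π,π] satisfies Condition(τ,C₀'), then for every x ∈ ℝ² with n^{5τ−1/2} ≤ ‖x‖₂ ≤ n^{1−8τ} one has ∏_{i=1}^{n} |∫_ℝ e^{√(−1)·s·⟨v_i,x⟩} dμ(s)| · |∫_ℝ e^{√(−1)·s·⟨v_i',x⟩} dμ(s)| ≤ e^{−n^{τ}}. -/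

import Mathlib

open MeasureTheory ProbabilityTheory Real

/-- `t` satisfies Condition(τ, C₀'): there is no nonzero integer `k` with `|k| ≤ C₀'` such that
`‖kt/π‖_{ℝ/ℤ} ≤ n^{-1+8τ}`. -/
def Condition (n : ℕ) (τ C₀' t : ℝ) : Prop :=
  ∀ k : ℤ, k ≠ 0 → |(k : ℝ)| ≤ C₀' →
    ∀ m : ℤ, (n : ℝ) ^ (-1 + 8 * τ) < |(k : ℝ) * t / Real.pi - (m : ℝ)|

/-- `⟨v_i, x⟩` where `v_i = (cos(it), -(i/n) sin(it))`. -/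
noncomputable def ipv (n : ℕ) (t : ℝ) (i : ℕ) (x : ℝ × ℝ) : ℝ :=
  Real.cos (i * t) * x.1 + (-((i : ℝ) / n) * Real.sin (i * t)) * x.2

/-- `⟨v_i', x⟩` where `v_i' = (sin(it), (i/n) cos(it))`. -/
noncomputable def ipv' (n : ℕ) (t : ℝ) (i : ℕ) (x : ℝ × ℝ) : ℝ :=
  Real.sin (i * t) * x.1 + ((i : ℝ) / n) * Real.cos (i * t) * x.2


theorem abs_fwdDiff_iter_le {f : ℕ → ℝ} {b : ℝ} {N : ℕ} (h : ∀ i ≤ N, |f i| ≤ b) (m j : ℕ)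
    (hj : j + m ≤ N) : |(fwdDiff 1)^[m] f j| ≤ 2 ^ m * b := by
  induction m generalizing j with
  | zero => simpa using h j (by omega)
  | succ m ih =>
    rw [Function.iterate_succ_apply', fwdDiff]
    have h1 := ih (j + 1) (by omega)
    have h2 := ih j (by omega)
    rw [pow_succ]
    rw [abs_le] at *
    constructor <;> linarith [h1.1, h1.2, h2.1, h2.2]

theorem fwdDiff_iter_sub_apply {G : Type*} [AddCommGroup G] (f g : ℕ → G) (m j : ℕ) :
    (fwdDiff 1)^[m] (fun i => f i - g i) j = (fwdDiff 1)^[m] f j - (fwdDiff 1)^[m] g j := by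
  induction m generalizing j with
  | zero => rfl
  | succ m ih =>
    simp only [Function.iterate_succ_apply', fwdDiff, ih]
    abel

theorem map_fwdDiff_iter {G H : Type*} [AddCommGroup G] [AddCommGroup H] (φ : G →+ H)
    (f : ℕ → G) (m j : ℕ) :
    φ ((fwdDiff 1)^[m] f j) = (fwdDiff 1)^[m] (fun i => φ (f i)) j := by
  induction m generalizing j with
  | zero => rfl
  | succ m ih => simp only [Function.iterate_succ_apply', fwdDiff, map_sub, ih]

theorem eq_const_of_fwdDiff_iter_eq_zero {p : ℕ → ℤ} {b : ℝ} {N m : ℕ}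
    (hb : ∀ i ≤ N, |(p i : ℝ)| ≤ b) (h0 : ∀ j, j + m ≤ N → (fwdDiff 1)^[m] p j = 0)
    (hN : 2 ^ m * b + m < N + 1) : ∀ i ≤ N, p i = p 0 := by
  have hb0 : 0 ≤ b := (abs_nonneg _).trans (hb 0 (Nat.zero_le _))
  induction m with
  | zero =>
    intro i hi
    have h1 := h0 i (by omega)
    have h2 := h0 0 (by omega)
    simp only [Function.iterate_zero, id] at h1 h2
    rw [h1, h2]
  | succ m ih =>
    rcases m with _ | m
    · intro i hi
      induction i with
      | zero => rfl
      | succ i ihi =>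
        have h1 := h0 i (by omega)
        simp only [zero_add, Function.iterate_one, fwdDiff] at h1
        rw [← ihi (by omega)]
        omega
    have hmN : m + 2 ≤ N := by
      have h1 : (0 : ℝ) ≤ 2 ^ (m + 1 + 1) * b := by positivity
      have h2 : ((m + 1 + 1 : ℕ) : ℝ) < ((N + 1 : ℕ) : ℝ) := by push_cast at hN ⊢; linarith
      have := Nat.cast_lt.mp h2
      omega
    have hc : ∀ j, j + (m + 1) ≤ N → (fwdDiff 1)^[m + 1] p j = (fwdDiff 1)^[m + 1] p 0 := by
      intro j hj
      induction j with
      | zero => rfl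
      | succ j ihj =>
        have h1 := h0 j (by omega)
        rw [Function.iterate_succ_apply', fwdDiff] at h1
        rw [← ihj (by omega)]
        omega
    have hlin : ∀ i, i + m ≤ N →
        (fwdDiff 1)^[m] p i = (fwdDiff 1)^[m] p 0 + i * (fwdDiff 1)^[m + 1] p 0 := by
      intro i hi
      induction i with
      | zero => simp
      | succ i ihi =>
        have h1 : (fwdDiff 1)^[m] p (i + 1) - (fwdDiff 1)^[m] p i = (fwdDiff 1)^[m + 1] p 0 := by
          rw [← hc i (by omega), Function.iterate_succ_apply']
          rfl
        have h2 := ihi (by omega)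
        push_cast
        linarith
    have hzero : (fwdDiff 1)^[m + 1] p 0 = 0 := by
      by_contra hne
      have h1 := hlin (N - m) (by omega)
      have habs : ∀ i, i + m ≤ N → |(((fwdDiff 1)^[m] p i : ℤ) : ℝ)| ≤ 2 ^ m * b := by
        intro i hi
        have := map_fwdDiff_iter (Int.castAddHom ℝ) p m i
        simp only [Int.coe_castAddHom] at this
        rw [this]
        exact abs_fwdDiff_iter_le hb m i hi
      have h2 := habs (N - m) (by omega)
      have h3 := habs 0 (by omega)
      have h4 : (1 : ℝ) ≤ |(((fwdDiff 1)^[m + 1] p 0 : ℤ) : ℝ)| := by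
        exact_mod_cast Int.one_le_abs hne
      have h5 : ((N - m : ℕ) : ℝ) * (((fwdDiff 1)^[m + 1] p 0 : ℤ) : ℝ)
          = (((fwdDiff 1)^[m] p (N - m) : ℤ) : ℝ) - (((fwdDiff 1)^[m] p 0 : ℤ) : ℝ) := by
        rw [h1]; push_cast; ring
      have h6 := congrArg abs h5
      rw [abs_mul, Nat.abs_cast] at h6
      have h7 := abs_sub (((fwdDiff 1)^[m] p (N - m) : ℤ) : ℝ) (((fwdDiff 1)^[m] p 0 : ℤ) : ℝ)
      have h8 : ((N - m : ℕ) : ℝ) ≤ ((N - m : ℕ) : ℝ) * |(((fwdDiff 1)^[m + 1] p 0 : ℤ) : ℝ)| :=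
        le_mul_of_one_le_right (by positivity) h4
      rw [Nat.cast_sub (by omega)] at *
      have h9 : (0 : ℝ) ≤ 2 ^ m * b := by positivity
      push_cast at hN
      rw [pow_succ, pow_succ] at hN
      linarith
    refine ih (fun j hj => (hc j hj).trans hzero) ?_
    have h9 : (0 : ℝ) ≤ 2 ^ m * b := by positivity
    push_cast at hN ⊢
    rw [pow_succ, pow_succ] at hN
    rw [pow_succ]
    linarith

theorem round_eq_const {u : ℕ → ℝ} {b δ : ℝ} {N m : ℕ}
    (hδ : ∀ i ≤ N, |u i - round (u i)| ≤ δ) (hb : ∀ i ≤ N, |u i| ≤ b)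
    (hu : ∀ j, j + m ≤ N → |(fwdDiff 1)^[m] u j| ≤ 1 / 4) (hmδ : 2 ^ m * δ ≤ 1 / 4)
    (hN : 2 ^ m * (b + 1) + m < N + 1) : ∀ i ≤ N, round (u i) = round (u 0) := by
  refine eq_const_of_fwdDiff_iter_eq_zero (p := fun i => round (u i)) (b := b + 1) (m := m) ?_ ?_ hN
  · intro i hi
    have h1 := hb i hi
    have h2 := abs_sub_round (u i)
    rw [abs_le] at *
    constructor <;> linarith [h1.1, h1.2, h2.1, h2.2]
  · intro j hj
    have h1 := map_fwdDiff_iter (Int.castAddHom ℝ) (fun i => round (u i)) m j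
    have h2 := abs_fwdDiff_iter_le hδ m j hj
    rw [fwdDiff_iter_sub_apply u (fun i => (round (u i) : ℝ))] at h2
    simp only [Int.coe_castAddHom] at h1
    rw [← h1] at h2
    have h3 := hu j hj
    rw [← Int.abs_lt_one_iff]
    have : |(((fwdDiff 1)^[m] (fun i => round (u i)) j : ℤ) : ℝ)| < 1 := by
      rw [abs_le] at *
      rw [abs_lt]
      constructor <;> linarith [h2.1, h2.2, h3.1, h3.2]
    exact_mod_cast this

/-- Each differencing step shrinks the weighted size `‖α‖ + L ‖β‖` by a factor `2η`. -/
theorem norm_fwdDiff_iter_le {W : ℂ} {η L : ℝ} (hW : ‖W‖ = 1) (hWη : ‖W - 1‖ ≤ η)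
    (hL : 1 ≤ η * L) (hL0 : 0 ≤ L) (m : ℕ) (α β : ℂ) (j : ℕ) (hj : (j : ℝ) ≤ L) :
    ‖(fwdDiff 1)^[m] (fun i : ℕ => W ^ i * (α + i * β)) j‖ ≤ (2 * η) ^ m * (‖α‖ + L * ‖β‖) := by
  induction m generalizing α β with
  | zero =>
    simp only [Function.iterate_zero, id, pow_zero, one_mul, norm_mul, norm_pow, hW, one_pow]
    refine (norm_add_le _ _).trans ?_
    rw [norm_mul, Complex.norm_natCast]
    gcongr
  | succ m ih =>
    have hη : 0 ≤ η := (norm_nonneg _).trans hWη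
    rw [Function.iterate_succ_apply]
    have hstep : fwdDiff 1 (fun i : ℕ => W ^ i * (α + i * β))
        = fun i : ℕ => W ^ i * (((W - 1) * α + W * β) + i * ((W - 1) * β)) := by
      funext i
      simp only [fwdDiff]
      push_cast
      ring
    rw [hstep]
    refine (ih _ _).trans ?_
    rw [pow_succ, mul_assoc]
    gcongr
    have h1 : ‖(W - 1) * α + W * β‖ ≤ η * ‖α‖ + ‖β‖ := by
      refine (norm_add_le _ _).trans ?_
      rw [norm_mul, norm_mul, hW, one_mul]
      gcongr
    have h2 : ‖(W - 1) * β‖ ≤ η * ‖β‖ := by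
      rw [norm_mul]; gcongr
    have h3 : L * ‖(W - 1) * β‖ ≤ L * (η * ‖β‖) := by gcongr
    have h4 : ‖β‖ ≤ η * L * ‖β‖ := le_mul_of_one_le_left (norm_nonneg _) hL
    have h5 : 0 ≤ η * ‖α‖ := by positivity
    linarith

/-- A twisted linear progression whose terms all lie near Gaussian integers starts near `0`,
unless all short powers of the twist are near `1`. -/
theorem near_gaussian_dichotomy {W α β : ℂ} {η δ S : ℝ} {N m : ℕ} (hW : ‖W‖ = 1)
    (hWη : ‖W - 1‖ ≤ η) (hL : 1 ≤ η * N) (hS : ‖α‖ + N * ‖β‖ ≤ S)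
    (hm : (2 * η) ^ m * S ≤ 1 / 4) (hmδ : 2 ^ m * δ ≤ 1 / 4)
    (hN : 2 ^ m * (S + 1) + m < N + 1)
    (hre : ∀ i ≤ N, |(W ^ i * (α + i * β)).re - round (W ^ i * (α + i * β)).re| ≤ δ)
    (him : ∀ i ≤ N, |(W ^ i * (α + i * β)).im - round (W ^ i * (α + i * β)).im| ≤ δ) :
    ‖α‖ ≤ 2 * δ ∨ ∀ h : ℕ, 2 * h ≤ N → ‖W ^ h - 1‖ ^ 2 ≤ 8 * δ := by
  have hη : 0 ≤ η := (norm_nonneg _).trans hWη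
  set ζ : ℕ → ℂ := fun i => W ^ i * (α + i * β) with hζ
  have hΔ : ∀ j ≤ N, ‖(fwdDiff 1)^[m] ζ j‖ ≤ 1 / 4 := fun j hj =>
    (norm_fwdDiff_iter_le hW hWη hL (by positivity) m α β j (by exact_mod_cast hj)).trans
      (le_trans (by gcongr) hm)
  have hbd : ∀ j ≤ N, ‖ζ j‖ ≤ S := by
    intro j hj
    refine le_trans ?_ hS
    have := norm_fwdDiff_iter_le hW hWη hL (by positivity) 0 α β j (by exact_mod_cast hj)
    simpa only [Function.iterate_zero, id, pow_zero, one_mul] using this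
  have cre := round_eq_const (u := fun i => (ζ i).re) hre
    (fun i hi => (Complex.abs_re_le_norm _).trans (hbd i hi)) (m := m)
    (fun j hj => by
      have := map_fwdDiff_iter Complex.reLm.toAddMonoidHom ζ m j
      simp only [LinearMap.toAddMonoidHom_coe, Complex.reLm_coe] at this
      rw [← this]
      exact (Complex.abs_re_le_norm _).trans (hΔ j (by omega))) hmδ hN
  have cim := round_eq_const (u := fun i => (ζ i).im) him
    (fun i hi => (Complex.abs_im_le_norm _).trans (hbd i hi)) (m := m)
    (fun j hj => by
      have := map_fwdDiff_iter Complex.imLm.toAddMonoidHom ζ m j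
      simp only [LinearMap.toAddMonoidHom_coe, Complex.imLm_coe] at this
      rw [← this]
      exact (Complex.abs_im_le_norm _).trans (hΔ j (by omega))) hmδ hN
  set a : ℤ := round (ζ 0).re with ha
  set b : ℤ := round (ζ 0).im with hb
  set P : ℂ := ⟨a, b⟩ with hP
  have hclose : ∀ i ≤ N, ‖ζ i - P‖ ≤ 2 * δ := by
    intro i hi
    have h1 := hre i hi
    have h2 := him i hi
    have e1 : round (ζ i).re = a := cre i hi
    have e2 : round (ζ i).im = b := cim i hi
    change |(ζ i).re - round (ζ i).re| ≤ δ at h1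
    change |(ζ i).im - round (ζ i).im| ≤ δ at h2
    rw [e1] at h1
    rw [e2] at h2
    refine (Complex.norm_le_abs_re_add_abs_im _).trans ?_
    simp only [Complex.sub_re, Complex.sub_im, hP]
    linarith
  by_cases hP0 : P = 0
  · left
    have := hclose 0 (Nat.zero_le _)
    simpa [hP0, hζ] using this
  · right
    intro h hh
    have hP1 : 1 ≤ ‖P‖ := by
      by_cases ha0 : a = 0
      · have hb0 : b ≠ 0 := by
          intro hb0
          apply hP0
          rw [hP, ha0, hb0]
          simp [Complex.ext_iff]
        refine le_trans ?_ (Complex.abs_im_le_norm P)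
        simp only [hP]
        exact_mod_cast Int.one_le_abs hb0
      · refine le_trans ?_ (Complex.abs_re_le_norm P)
        simp only [hP]
        exact_mod_cast Int.one_le_abs ha0
    have key : (W ^ h - 1) ^ 2 * P = -((ζ (2 * h) - P) - 2 * W ^ h * (ζ h - P)
        + W ^ h * W ^ h * (ζ 0 - P)) := by
      simp only [hζ]
      push_cast
      rw [pow_mul']
      ring
    have hWh : ‖W ^ h‖ = 1 := by rw [norm_pow, hW, one_pow]
    have h1 := hclose (2 * h) hh
    have h2 := hclose h (by omega)
    have h3 := hclose 0 (by omega)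
    have h4 : ‖(W ^ h - 1) ^ 2 * P‖ ≤ 8 * δ := by
      rw [key, norm_neg]
      refine (norm_add_le _ _).trans ?_
      have h5 := norm_sub_le (ζ (2 * h) - P) (2 * W ^ h * (ζ h - P))
      have h6 : ‖2 * W ^ h * (ζ h - P)‖ = 2 * ‖ζ h - P‖ := by
        rw [norm_mul, norm_mul, hWh]; norm_num
      have h7 : ‖W ^ h * W ^ h * (ζ 0 - P)‖ = ‖ζ 0 - P‖ := by
        rw [norm_mul, norm_mul, hWh]; norm_num
      linarith
    rw [norm_mul, norm_pow] at h4
    exact (le_mul_of_one_le_right (by positivity) hP1).trans h4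

theorem exists_block_lt {g : ℕ → ℝ} (hg : ∀ j, 0 ≤ g j) {n a B Q : ℕ} {c : ℝ} (ha : 1 ≤ a)
    (hB : 0 < B) (hn : a + Q * B ≤ n + 1) (hsum : ∑ j ∈ Finset.Icc 1 n, g j < Q * c) :
    ∃ s, a ≤ s ∧ s + B ≤ n + 1 ∧ ∀ j, s ≤ j → j < s + B → g j < c := by
  by_contra! hcon
  have hq : ∀ q : ℕ, ∃ j, q < Q → a + q * B ≤ j ∧ j < a + q * B + B ∧ c ≤ g j := by
    intro q
    by_cases hq : q < Q
    · have : (q + 1) * B ≤ Q * B := Nat.mul_le_mul_right _ hq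
      obtain ⟨j, h1, h2, h3⟩ := hcon (a + q * B) (by omega) (by rw [add_mul] at this; omega)
      exact ⟨j, fun _ => ⟨h1, h2, h3⟩⟩
    · exact ⟨0, fun h => absurd h hq⟩
  choose f hf using hq
  have hinj : Set.InjOn f (Finset.range Q) := by
    have hdiv : ∀ q < Q, (f q - a) / B = q := by
      intro q hq
      obtain ⟨h1, h2, -⟩ := hf q hq
      rw [Nat.div_eq_iff hB]
      constructor <;> omega
    intro p hp q hq hpq
    simp only [Finset.coe_range, Set.mem_Iio] at hp hq
    rw [← hdiv p hp, ← hdiv q hq, hpq]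
  have h1 : (Q : ℝ) * c ≤ ∑ q ∈ Finset.range Q, g (f q) := by
    have := Finset.card_nsmul_le_sum (Finset.range Q) (fun q => g (f q)) c
      (fun q hq => (hf q (Finset.mem_range.mp hq)).2.2)
    simpa using this
  have h2 : ∑ q ∈ Finset.range Q, g (f q) = ∑ j ∈ (Finset.range Q).image f, g j :=
    (Finset.sum_image hinj).symm
  have h3 : ∑ j ∈ (Finset.range Q).image f, g j ≤ ∑ j ∈ Finset.Icc 1 n, g j := by
    refine Finset.sum_le_sum_of_subset_of_nonneg ?_ (fun _ _ _ => hg _)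
    intro j hj
    obtain ⟨q, hq, rfl⟩ := Finset.mem_image.mp hj
    have hq := Finset.mem_range.mp hq
    obtain ⟨h1, h2, -⟩ := hf q hq
    have : (q + 1) * B ≤ Q * B := Nat.mul_le_mul_right _ hq
    rw [add_mul] at this
    exact Finset.mem_Icc.mpr ⟨by omega, by omega⟩
  linarith

theorem exp_mul_eq_ipv (n j : ℕ) (t : ℝ) (y : ℝ × ℝ) :
    Complex.exp (Complex.I * ((j * t : ℝ) : ℂ)) * ((y.1 : ℂ) + Complex.I * ((j / n * y.2 : ℝ) : ℂ))
      = ⟨ipv n t j y, ipv' n t j y⟩ := by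
  rw [mul_comm Complex.I ((j * t : ℝ) : ℂ)]
  apply Complex.ext
  · simp only [Complex.mul_re, Complex.add_re, Complex.add_im, Complex.mul_im, Complex.ofReal_re,
      Complex.ofReal_im, Complex.I_re, Complex.I_im, Complex.exp_ofReal_mul_I_re,
      Complex.exp_ofReal_mul_I_im, ipv]
    ring
  · simp only [Complex.mul_re, Complex.add_re, Complex.add_im, Complex.mul_im, Complex.ofReal_re,
      Complex.ofReal_im, Complex.I_re, Complex.I_im, Complex.exp_ofReal_mul_I_re,
      Complex.exp_ofReal_mul_I_im, ipv']
    ring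

theorem ipv_sq_add_ipv'_sq (n j : ℕ) (t : ℝ) (y : ℝ × ℝ) :
    ipv n t j y ^ 2 + ipv' n t j y ^ 2 = y.1 ^ 2 + ((j : ℝ) / n) ^ 2 * y.2 ^ 2 := by
  simp only [ipv, ipv']
  linear_combination (y.1 ^ 2 + ((j : ℝ) / n) ^ 2 * y.2 ^ 2) * Real.sin_sq_add_cos_sq (j * t)

theorem exists_pow_exp_far {ρ : ℝ} (hρ0 : 0 < |ρ|) (hρ1 : |ρ| ≤ 1) {N : ℕ}
    (hN : 2 * (1 / |ρ| + 1) ≤ N) :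
    ∃ h : ℕ, 2 * h ≤ N ∧ 8 / 9 ≤ ‖Complex.exp (Complex.I * ρ) ^ h - 1‖ ^ 2 := by
  refine ⟨⌈1 / |ρ|⌉₊, ?_, ?_⟩
  · have h1 := (Nat.ceil_lt_add_one (show 0 ≤ 1 / |ρ| by positivity)).le
    have h2 : ((2 * ⌈1 / |ρ|⌉₊ : ℕ) : ℝ) ≤ N := by push_cast; linarith
    exact_mod_cast h2
  · set h := ⌈1 / |ρ|⌉₊ with hh
    have h1 : 1 / |ρ| ≤ h := Nat.le_ceil _
    have h2 : (h : ℝ) ≤ 1 / |ρ| + 1 := (Nat.ceil_lt_add_one (by positivity)).le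
    have h3 : 1 ≤ h * |ρ| := by rwa [div_le_iff₀ hρ0] at h1
    have h4 : h * |ρ| ≤ 2 := by
      have : h * |ρ| ≤ (1 / |ρ| + 1) * |ρ| := by gcongr
      have e : (1 / |ρ| + 1) * |ρ| = 1 + |ρ| := by field_simp
      linarith
    have h5 : Complex.exp (Complex.I * ρ) ^ h = Complex.exp (Complex.I * ((h * ρ : ℝ) : ℂ)) := by
      rw [← Complex.exp_nat_mul]
      push_cast
      ring_nf
    rw [h5, Complex.norm_exp_I_mul_ofReal_sub_one, Real.norm_eq_abs, sq_abs]
    have h6 : Real.cos (h * |ρ|) ≤ 5 / 9 := by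
      refine le_trans (Real.cos_le_cos_of_nonneg_of_le_pi zero_le_one ?_ h3) Real.cos_one_le
      linarith [Real.pi_gt_three]
    have h7 : Real.cos (h * |ρ|) = Real.cos (h * ρ) := by
      rw [← Real.cos_abs (h * ρ), abs_mul, Nat.abs_cast]
    have h8 := Real.sin_sq_eq_half_sub (h * ρ / 2)
    rw [mul_div_cancel₀ _ two_ne_zero] at h8
    linarith

theorem norm_le_of_near_integers {n s N k m : ℕ} {t η δ S ρ : ℝ} {l : ℤ} {y : ℝ × ℝ}
    (hn : 0 < n) (hs : (n : ℝ) ≤ 2 * s) (hsn : s + N * k ≤ n)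
    (hρ : ρ = k * t - l * (2 * Real.pi)) (hρη : |ρ| ≤ η) (hρ0 : 0 < |ρ|) (hρ1 : |ρ| ≤ 1)
    (hηN : 1 ≤ η * N) (hρN : 2 * (1 / |ρ| + 1) ≤ N) (hδ : δ < 1 / 9)
    (hS : |y.1| + |y.2| ≤ S) (hm : (2 * η) ^ m * S ≤ 1 / 4) (hmδ : 2 ^ m * δ ≤ 1 / 4)
    (hN : 2 ^ m * (S + 1) + m < N + 1)
    (h₁ : ∀ j, s ≤ j → j ≤ s + N * k → |ipv n t j y - round (ipv n t j y)| ≤ δ)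
    (h₂ : ∀ j, s ≤ j → j ≤ s + N * k → |ipv' n t j y - round (ipv' n t j y)| ≤ δ) :
    Real.sqrt (y.1 ^ 2 + y.2 ^ 2) ≤ 4 * δ := by
  have hn' : (0 : ℝ) < n := by exact_mod_cast hn
  set W := Complex.exp (Complex.I * ρ) with hWdef
  set E := Complex.exp (Complex.I * ((s * t : ℝ) : ℂ)) with hE
  set α : ℂ := E * ((y.1 : ℂ) + Complex.I * ((s / n * y.2 : ℝ) : ℂ)) with hα
  set β : ℂ := E * (Complex.I * ((k / n * y.2 : ℝ) : ℂ)) with hβ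
  have hW : ‖W‖ = 1 := Complex.norm_exp_I_mul_ofReal ρ
  have hE1 : ‖E‖ = 1 := Complex.norm_exp_I_mul_ofReal _
  have hWk : W = Complex.exp (Complex.I * ((k * t : ℝ) : ℂ)) := by
    rw [hWdef, hρ, Complex.exp_eq_exp_iff_exists_int]
    exact ⟨-l, by push_cast; ring⟩
  have hseq : ∀ i : ℕ, W ^ i * (α + i * β) = ⟨ipv n t (s + i * k) y, ipv' n t (s + i * k) y⟩ := by
    intro i
    rw [← exp_mul_eq_ipv]
    have : Complex.exp (Complex.I * (((s + i * k : ℕ) * t : ℝ) : ℂ)) = W ^ i * E := by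
      rw [hWk, hE, ← Complex.exp_nat_mul, ← Complex.exp_add]
      congr 1
      push_cast
      ring
    rw [this, hα, hβ]
    push_cast
    ring
  have hSle : ‖α‖ + N * ‖β‖ ≤ S := by
    refine le_trans ?_ hS
    have h1 : ‖α‖ ≤ |y.1| + s / n * |y.2| := by
      rw [hα, norm_mul, hE1, one_mul]
      refine (norm_add_le _ _).trans ?_
      rw [norm_mul, Complex.norm_I, one_mul, Complex.norm_real, Complex.norm_real,
        Real.norm_eq_abs, Real.norm_eq_abs, abs_mul, abs_of_nonneg (by positivity : (0 : ℝ) ≤ s / n)]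
    have h2 : ‖β‖ = k / n * |y.2| := by
      rw [hβ, norm_mul, hE1, one_mul, norm_mul, Complex.norm_I, one_mul, Complex.norm_real,
        Real.norm_eq_abs, abs_mul, abs_of_nonneg (by positivity : (0 : ℝ) ≤ k / n)]
    have h3 : ((s : ℝ) + N * k) / n ≤ 1 := by
      rw [div_le_one hn']
      exact_mod_cast hsn
    have h4 : ((s : ℝ) + N * k) / n * |y.2| ≤ 1 * |y.2| := by gcongr
    have e : ((s : ℝ) + N * k) / n * |y.2| = s / n * |y.2| + N * (k / n * |y.2|) := by ring
    rw [h2]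
    linarith
  have hik : ∀ i ≤ N, s ≤ s + i * k ∧ s + i * k ≤ s + N * k := fun i hi =>
    ⟨by omega, by have := Nat.mul_le_mul_right k hi; omega⟩
  rcases near_gaussian_dichotomy hW (norm_exp_I_mul_ofReal_sub_one_le.trans hρη) hηN hSle hm hmδ hN
    (fun i hi => by rw [hseq]; exact h₁ _ (hik i hi).1 (hik i hi).2)
    (fun i hi => by rw [hseq]; exact h₂ _ (hik i hi).1 (hik i hi).2) with h | h
  · have hsq : ‖α‖ ^ 2 = y.1 ^ 2 + ((s : ℝ) / n) ^ 2 * y.2 ^ 2 := by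
      rw [hα, exp_mul_eq_ipv, Complex.sq_norm, Complex.normSq_mk, ← ipv_sq_add_ipv'_sq n s t y]
      ring
    have hsn2 : 1 / 2 ≤ (s : ℝ) / n := by
      rw [le_div_iff₀ hn']
      linarith
    have h1 : (1 / 2 : ℝ) ^ 2 ≤ ((s : ℝ) / n) ^ 2 := by gcongr
    have h2 : ‖α‖ ^ 2 ≤ (2 * δ) ^ 2 := by gcongr
    have h3 : (1 / 2 : ℝ) ^ 2 * y.2 ^ 2 ≤ ((s : ℝ) / n) ^ 2 * y.2 ^ 2 := by gcongr
    apply Real.sqrt_le_iff.mpr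
    have h4 := norm_nonneg α
    refine ⟨by linarith, ?_⟩
    nlinarith [sq_nonneg y.1]
  · obtain ⟨h0, hh1, hh2⟩ := exists_pow_exp_far hρ0 hρ1 hρN
    have := h h0 hh1
    linarith

theorem eight_mul_sq_le_one_sub_cos {v : ℝ} (hv : |v| ≤ 1 / 2) :
    8 * v ^ 2 ≤ 1 - Real.cos (2 * Real.pi * v) := by
  have h := Real.cos_le_one_sub_mul_cos_sq (x := 2 * Real.pi * v) (by
    rw [abs_mul, abs_of_pos Real.two_pi_pos]
    nlinarith [Real.pi_pos])
  have e : 2 / Real.pi ^ 2 * (2 * Real.pi * v) ^ 2 = 8 * v ^ 2 := by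
    have := Real.pi_ne_zero
    field_simp
    ring
  linarith

theorem eight_mul_sub_round_sq_le (w : ℝ) :
    8 * (w - round w) ^ 2 ≤ 1 - Real.cos (2 * Real.pi * w) := by
  have h := eight_mul_sq_le_one_sub_cos (abs_sub_round w)
  rwa [mul_sub, mul_comm (2 * Real.pi) (round w : ℝ), Real.cos_sub_int_mul_two_pi] at h

theorem cube_div_three_le_sum_sq (n : ℕ) :
    (n : ℝ) ^ 3 / 3 ≤ ∑ j ∈ Finset.Icc 1 n, (j : ℝ) ^ 2 := by
  induction n with
  | zero => simp
  | succ n ih =>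
    rw [Finset.sum_Icc_succ_top (by omega)]
    push_cast
    nlinarith [Nat.cast_nonneg (α := ℝ) n]

/-- The sum of `1 - cos` over both families of inner products. -/
noncomputable def cosDefect (n : ℕ) (t : ℝ) (y : ℝ × ℝ) (j : ℕ) : ℝ :=
  (1 - Real.cos (2 * Real.pi * ipv n t j y)) + (1 - Real.cos (2 * Real.pi * ipv' n t j y))

theorem cosDefect_nonneg (n : ℕ) (t : ℝ) (y : ℝ × ℝ) (j : ℕ) : 0 ≤ cosDefect n t y j := by
  unfold cosDefect
  linarith [Real.cos_le_one (2 * Real.pi * ipv n t j y),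
    Real.cos_le_one (2 * Real.pi * ipv' n t j y)]

theorem sum_cosDefect_of_small {n : ℕ} (hn : 0 < n) (t : ℝ) {y : ℝ × ℝ}
    (hy : y.1 ^ 2 + y.2 ^ 2 ≤ 1 / 4) :
    n * (y.1 ^ 2 + y.2 ^ 2) ≤ ∑ j ∈ Finset.Icc 1 n, cosDefect n t y j := by
  have hn' : (0 : ℝ) < n := by exact_mod_cast hn
  have h1 : ∀ j ∈ Finset.Icc 1 n,
      8 * (y.1 ^ 2 + y.2 ^ 2) / n ^ 2 * (j : ℝ) ^ 2 ≤ cosDefect n t y j := by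
    intro j hj
    have hjn : (j : ℝ) / n ≤ 1 := by
      rw [div_le_one hn']
      exact_mod_cast (Finset.mem_Icc.mp hj).2
    have hj2 : ((j : ℝ) / n) ^ 2 ≤ 1 := pow_le_one₀ (by positivity) hjn
    have e := ipv_sq_add_ipv'_sq n j t y
    have h2 : ((j : ℝ) / n) ^ 2 * y.2 ^ 2 ≤ 1 * y.2 ^ 2 := by gcongr
    have h3 : ((j : ℝ) / n) ^ 2 * y.1 ^ 2 ≤ 1 * y.1 ^ 2 := by gcongr
    have ha : |ipv n t j y| ≤ 1 / 2 := by
      apply abs_le_of_sq_le_sq _ (by norm_num)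
      nlinarith [sq_nonneg (ipv' n t j y)]
    have hb : |ipv' n t j y| ≤ 1 / 2 := by
      apply abs_le_of_sq_le_sq _ (by norm_num)
      nlinarith [sq_nonneg (ipv n t j y)]
    have h4 := eight_mul_sq_le_one_sub_cos ha
    have h5 := eight_mul_sq_le_one_sub_cos hb
    have e2 : 8 * (y.1 ^ 2 + y.2 ^ 2) / n ^ 2 * (j : ℝ) ^ 2
        = 8 * (((j : ℝ) / n) ^ 2 * y.1 ^ 2 + ((j : ℝ) / n) ^ 2 * y.2 ^ 2) := by
      field_simp
    unfold cosDefect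
    linarith
  refine le_trans ?_ (Finset.sum_le_sum h1)
  rw [← Finset.mul_sum]
  have h2 : 8 * (y.1 ^ 2 + y.2 ^ 2) / n ^ 2 * ((n : ℝ) ^ 3 / 3)
      ≤ 8 * (y.1 ^ 2 + y.2 ^ 2) / n ^ 2 * ∑ j ∈ Finset.Icc 1 n, (j : ℝ) ^ 2 := by
    gcongr
    exact cube_div_three_le_sum_sq n
  refine le_trans ?_ h2
  have e : 8 * (y.1 ^ 2 + y.2 ^ 2) / n ^ 2 * ((n : ℝ) ^ 3 / 3)
      = 8 / 3 * (n * (y.1 ^ 2 + y.2 ^ 2)) := by field_simp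
  rw [e]
  have : 0 ≤ n * (y.1 ^ 2 + y.2 ^ 2) := by positivity
  linarith

theorem two_pow_clog_le {n R : ℕ} {Z : ℝ} (hn : 0 < n) (hR : 0 < R) (hZ : 1 ≤ Z)
    (hZn : (n : ℝ) ≤ Z ^ R) : (2 : ℝ) ^ Nat.clog (2 ^ R) (8 * n) ≤ 16 * Z := by
  set m := Nat.clog (2 ^ R) (8 * n) with hm
  have hb : 1 < 2 ^ R := Nat.one_lt_two_pow hR.ne'
  have h1 : (2 ^ R) ^ (m - 1) < 8 * n := Nat.pow_pred_clog_lt_self hb (by omega)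
  have h2 : (2 : ℝ) ^ (m - 1) ≤ 8 * Z := by
    by_contra! hlt
    have h3 : (8 * Z) ^ R ≤ ((2 : ℝ) ^ (m - 1)) ^ R := by gcongr
    have h4 : ((2 : ℝ) ^ (m - 1)) ^ R < 8 * n := by
      rw [← pow_mul, mul_comm, pow_mul]
      exact_mod_cast h1
    have h5 : (8 : ℝ) ≤ 8 ^ R := le_self_pow₀ (by norm_num) hR.ne'
    rw [mul_pow] at h3
    have h6 : (8 : ℝ) * n ≤ 8 ^ R * Z ^ R := by gcongr
    linarith
  have h3 : (2 : ℝ) ^ m ≤ 2 ^ (m - 1 + 1) := pow_le_pow_right₀ (by norm_num) (by omega)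
  rw [pow_succ] at h3
  linarith

set_option maxHeartbeats 1000000 in
/-- The large-vector case, with the powers of `n` replaced by abstract quantities:
`Z = n ^ (τ / 2)` and `Y = n ^ (1 - 8 τ)`. -/
theorem sum_cosDefect_of_large {n R K : ℕ} {t Y Z c₂ T : ℝ} {y : ℝ × ℝ}
    (hR : 0 < R) (hK : K = 2 ^ (R + 4)) (hT : 0 ≤ T) (hc₂ : 0 ≤ c₂) (hY : 1 ≤ Y)
    (hZ64 : 64 ≤ Z) (hZc : 32 * (c₂ + 1) ≤ Z) (hZT : 2 * (T + 1) * (K + 1) ≤ Z)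
    (hnYZ : (n : ℝ) = Y * Z ^ 16) (hnR : (n : ℝ) ≤ Z ^ R)
    (ht : ∀ k : ℕ, 0 < k → k ≤ K → ∀ l : ℤ, 1 / Y < |(k : ℝ) * t / Real.pi - l|)
    (hy : Real.sqrt (y.1 ^ 2 + y.2 ^ 2) ≤ c₂ * Y)
    (hy' : 1 / 2 < Real.sqrt (y.1 ^ 2 + y.2 ^ 2)) :
    T * Z ^ 2 ≤ ∑ j ∈ Finset.Icc 1 n, cosDefect n t y j := by
  by_contra! hsum
  have hZ0 : 0 < Z := by linarith
  have hZ1 : 1 ≤ Z := by linarith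
  have hY0 : 0 < Y := by linarith
  have hn : 0 < n := by
    have : (0 : ℝ) < n := by rw [hnYZ]; positivity
    exact_mod_cast this
  have hKpos : 0 < K := by rw [hK]; positivity
  have hKr : (K : ℝ) = 16 * 2 ^ R := by rw [hK]; push_cast; ring
  have hK32 : (32 : ℝ) ≤ K := by
    have : (2 : ℝ) ≤ 2 ^ R := le_self_pow₀ (by norm_num) hR.ne'
    linarith
  have hZK : (K : ℝ) + 1 ≤ Z := by nlinarith
  set V := Y * Z ^ 8 with hV
  set N := ⌊V⌋₊ with hNdef
  have hV0 : 0 ≤ V := by positivity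
  have hNV : (N : ℝ) ≤ V := Nat.floor_le hV0
  have hVN : V < N + 1 := Nat.lt_floor_add_one V
  have hYZV : Y * Z ≤ V := by
    rw [hV]
    gcongr
    exact le_self_pow₀ hZ1 (by norm_num)
  have hYZ2V : Y * (Z * Z) ≤ V := by
    rw [hV]
    gcongr
    rw [← pow_two]
    exact pow_le_pow_right₀ hZ1 (by norm_num)
  have hZV : Z ≤ V := by nlinarith
  -- a block of consecutive indices on which both inner products are near integers
  set δ := 1 / Z ^ 2 with hδ
  set Q := ⌈T * Z ^ 6⌉₊ with hQ
  have hQ1 : T * Z ^ 6 ≤ Q := Nat.le_ceil _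
  have hQ2 : (Q : ℝ) ≤ T * Z ^ 6 + 1 := (Nat.ceil_lt_add_one (by positivity)).le
  have hQB : n / 2 + 1 + Q * (N * K + 1) ≤ n + 1 := by
    have h1 : (Q : ℝ) ≤ (T + 1) * Z ^ 6 := by
      have : 1 ≤ Z ^ 6 := one_le_pow₀ hZ1
      linarith
    have h2 : (N : ℝ) * K + 1 ≤ (K + 1) * V := by
      have : (N : ℝ) * K ≤ V * K := by gcongr
      linarith
    have h3 : (Q : ℝ) * (N * K + 1) ≤ ((T + 1) * Z ^ 6) * ((K + 1) * V) := by gcongr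
    have h4 : 2 * (((T + 1) * Z ^ 6) * ((K + 1) * V)) ≤ n := by
      have e : 2 * (((T + 1) * Z ^ 6) * ((K + 1) * V))
          = (2 * (T + 1) * (K + 1)) * (Y * Z ^ 14) := by rw [hV]; ring
      rw [e, hnYZ]
      have : (2 * (T + 1) * (K + 1)) * (Y * Z ^ 14) ≤ Z * (Y * Z ^ 14) := by gcongr
      refine this.trans ?_
      have e2 : Z * (Y * Z ^ 14) = Y * Z ^ 15 := by ring
      rw [e2]
      gcongr
      norm_num
    have h5 : ((2 * (Q * (N * K + 1)) : ℕ) : ℝ) ≤ n := by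
      push_cast
      linarith
    have h6 : 2 * (Q * (N * K + 1)) ≤ n := by exact_mod_cast h5
    omega
  obtain ⟨s, hs1, hs2, hgood⟩ := exists_block_lt (c := 8 * δ ^ 2) (cosDefect_nonneg n t y)
    (by omega) (by positivity) hQB (by
      refine hsum.trans_le ?_
      have e : T * Z ^ 2 = T * Z ^ 6 * δ ^ 2 := by rw [hδ]; field_simp
      rw [e]
      have h1 : T * Z ^ 6 * δ ^ 2 ≤ Q * δ ^ 2 := by gcongr
      have h2 : 0 ≤ Q * δ ^ 2 := by positivity
      linarith)
  have hδ0 : 0 ≤ δ := by positivity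
  -- a bounded multiple of `t` near `2πℤ`
  obtain ⟨l, k', hk0, hkK, hkl⟩ := Real.exists_int_int_abs_mul_sub_le (t / (2 * Real.pi)) hKpos
  lift k' to ℕ using hk0.le with k
  have hk0 : 0 < k := by exact_mod_cast hk0
  have hkK : k ≤ K := by exact_mod_cast hkK
  obtain ⟨ρ, hρ⟩ : ∃ ρ : ℝ, ρ = k * t - l * (2 * Real.pi) := ⟨_, rfl⟩
  have hpi := Real.pi_pos
  have hρη : |ρ| ≤ 8 / K := by
    have e : ρ = ((k : ℤ) * (t / (2 * Real.pi)) - l) * (2 * Real.pi) := by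
      rw [hρ]; push_cast; field_simp
    rw [e, abs_mul, abs_of_pos Real.two_pi_pos]
    have h1 : |((k : ℤ) : ℝ) * (t / (2 * Real.pi)) - l| * (2 * Real.pi)
        ≤ 1 / (K + 1) * (2 * 4) := by
      gcongr
      exact Real.pi_le_four
    refine h1.trans ?_
    rw [div_mul_eq_mul_div, one_mul]
    norm_num
    gcongr
    linarith
  have hρY : 1 / Y < |ρ| := by
    have h1 := ht k hk0 hkK (2 * l)
    have e : (k : ℝ) * t / Real.pi - ((2 * l : ℤ) : ℝ) = ρ / Real.pi := by
      rw [hρ]; push_cast; field_simp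
    rw [e, abs_div, abs_of_pos hpi] at h1
    refine h1.trans_le (div_le_self (abs_nonneg _) ?_)
    linarith [Real.pi_gt_three]
  have hρ0 : 0 < |ρ| := lt_trans (by positivity) hρY
  have hρinv : 1 / |ρ| ≤ Y := by
    rw [div_le_iff₀ hρ0]
    rw [div_lt_iff₀ hY0] at hρY
    linarith
  have hρ1 : |ρ| ≤ 1 := hρη.trans (by rw [div_le_one (by positivity)]; linarith)
  -- the order of differencing
  set m := Nat.clog (2 ^ R) (8 * n) with hm
  have h2m : (2 : ℝ) ^ m ≤ 16 * Z := two_pow_clog_le hn hR hZ1 hnR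
  have hηm : (2 * (8 / (K : ℝ))) ^ m ≤ 1 / (8 * n) := by
    have e : 2 * (8 / (K : ℝ)) = 1 / 2 ^ R := by rw [hKr]; field_simp; norm_num
    rw [e, one_div_pow]
    apply one_div_le_one_div_of_le (by positivity)
    have := Nat.le_pow_clog (Nat.one_lt_two_pow hR.ne') (8 * n)
    exact_mod_cast this
  have hmle : (m : ℝ) ≤ 2 ^ m := by exact_mod_cast Nat.lt_two_pow_self.le
  have hsumabs : |y.1| + |y.2| ≤ 2 * c₂ * Y := by
    have h1 := Real.abs_le_sqrt (show y.1 ^ 2 ≤ y.1 ^ 2 + y.2 ^ 2 by linarith [sq_nonneg y.2])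
    have h2 := Real.abs_le_sqrt (show y.2 ^ 2 ≤ y.1 ^ 2 + y.2 ^ 2 by linarith [sq_nonneg y.1])
    linarith
  have hnear : ∀ w : ℝ, 1 - Real.cos (2 * Real.pi * w) < 8 * δ ^ 2 → |w - round w| ≤ δ := by
    intro w hw
    have := eight_mul_sub_round_sq_le w
    exact abs_le_of_sq_le_sq (by linarith) hδ0
  have hfin := norm_le_of_near_integers (n := n) (s := s) (N := N) (k := k) (m := m) (t := t)
    (η := 8 / K) (δ := δ) (S := 2 * c₂ * Y) (ρ := ρ) (l := l) (y := y) hn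
    (by
      have : n ≤ 2 * s := by omega
      exact_mod_cast this)
    (by
      have := Nat.mul_le_mul_left N hkK
      omega)
    hρ hρη hρ0 hρ1
    (by
      rw [div_mul_eq_mul_div, le_div_iff₀ (by positivity)]
      linarith)
    (by nlinarith)
    (by
      rw [hδ, div_lt_div_iff₀ (by positivity) (by norm_num)]
      nlinarith)
    hsumabs
    (by
      have h1 : (2 * (8 / (K : ℝ))) ^ m * (2 * c₂ * Y) ≤ 1 / (8 * n) * (2 * c₂ * Y) := by gcongr
      refine h1.trans ?_
      have h2 : c₂ * Y ≤ n := by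
        rw [hnYZ, mul_comm]
        gcongr
        exact le_trans (by linarith) (le_self_pow₀ hZ1 (by norm_num))
      rw [div_mul_eq_mul_div, div_le_div_iff₀ (by positivity) (by norm_num)]
      linarith)
    (by
      have h1 : (2 : ℝ) ^ m * δ ≤ 16 * Z * δ := by gcongr
      refine h1.trans ?_
      have e : 16 * Z * δ = 16 / Z := by rw [hδ]; field_simp
      rw [e, div_le_div_iff₀ hZ0 (by norm_num)]
      linarith)
    (by
      have h1 : (2 : ℝ) ^ m * (2 * c₂ * Y + 2) ≤ 16 * Z * (2 * c₂ * Y + 2) := by gcongr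
      have h2 : 16 * Z * (2 * c₂ * Y + 2) ≤ 32 * (c₂ + 1) * (Y * Z) := by nlinarith
      have h3 : 32 * (c₂ + 1) * (Y * Z) ≤ Z * (Y * Z) := by gcongr
      linarith)
    (fun j hj1 hj2 => hnear _ (by
      have h1 := hgood j hj1 (by have := Nat.mul_le_mul_left N hkK; omega)
      have h2 := Real.cos_le_one (2 * Real.pi * ipv' n t j y)
      unfold cosDefect at h1
      linarith))
    (fun j hj1 hj2 => hnear _ (by
      have h1 := hgood j hj1 (by have := Nat.mul_le_mul_left N hkK; omega)
      have h2 := Real.cos_le_one (2 * Real.pi * ipv n t j y)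
      unfold cosDefect at h1
      linarith))
  have hδ8 : δ < 1 / 8 := by
    rw [hδ, div_lt_div_iff₀ (by positivity) (by norm_num)]
    nlinarith
  linarith

theorem exists_sum_cosDefect_lower_bound {τ c₁ c₂ T : ℝ} (hτ : 0 < τ) (hτ' : τ ≤ 1 / 8)
    (hc₁ : 0 < c₁) (hc₂ : 0 ≤ c₂) (hT : 0 ≤ T) :
    ∃ K : ℕ, ∃ n₀ : ℕ, ∀ n : ℕ, n₀ ≤ n → ∀ t C : ℝ, K ≤ C → Condition n τ C t → ∀ y : ℝ × ℝ,
      c₁ * (n : ℝ) ^ (5 * τ - 1 / 2) ≤ Real.sqrt (y.1 ^ 2 + y.2 ^ 2) →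
      Real.sqrt (y.1 ^ 2 + y.2 ^ 2) ≤ c₂ * (n : ℝ) ^ (1 - 8 * τ) →
      T * (n : ℝ) ^ τ ≤ ∑ j ∈ Finset.Icc 1 n, cosDefect n t y j := by
  obtain ⟨R, hR⟩ := exists_nat_ge (2 / τ)
  have hR0 : 0 < R := by
    have : (0 : ℝ) < R := lt_of_lt_of_le (by positivity) hR
    exact_mod_cast this
  set K : ℕ := 2 ^ (R + 4) with hK
  have htend : Filter.Tendsto (fun n : ℕ => (n : ℝ) ^ (τ / 2)) Filter.atTop Filter.atTop :=
    (tendsto_rpow_atTop (by positivity)).comp tendsto_natCast_atTop_atTop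
  obtain ⟨n₀, hn₀⟩ := Filter.eventually_atTop.mp (htend.eventually_ge_atTop
    (64 + 32 * (c₂ + 1) + 2 * (T + 1) * (K + 1) + T / c₁ ^ 2))
  refine ⟨K, max n₀ 1, fun n hn t C hC ht y hy1 hy2 => ?_⟩
  have hZ := hn₀ n (le_trans (le_max_left _ _) hn)
  have hn1 : 1 ≤ n := le_trans (le_max_right _ _) hn
  have hnr : (1 : ℝ) ≤ n := by exact_mod_cast hn1
  have hnpos : (0 : ℝ) < n := by linarith
  set Z := (n : ℝ) ^ (τ / 2) with hZdef
  set Y := (n : ℝ) ^ (1 - 8 * τ) with hYdef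
  have hp1 : 0 ≤ 2 * (T + 1) * ((K : ℝ) + 1) := by positivity
  have hp2 : 0 ≤ T / c₁ ^ 2 := by positivity
  have hZpow : ∀ q : ℕ, Z ^ q = (n : ℝ) ^ (τ / 2 * q) := fun q => by
    rw [hZdef, ← Real.rpow_natCast, ← Real.rpow_mul hnpos.le]
  have hZ2 : (n : ℝ) ^ τ = Z ^ 2 := by
    rw [hZpow]; congr 1; push_cast; ring
  have hnYZ : (n : ℝ) = Y * Z ^ 16 := by
    rw [hZpow, hYdef, ← Real.rpow_add hnpos]
    conv_lhs => rw [← Real.rpow_one (n : ℝ)]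
    congr 1
    push_cast
    ring
  rw [hZ2]
  by_cases hy : Real.sqrt (y.1 ^ 2 + y.2 ^ 2) ≤ 1 / 2
  · have hr : Real.sqrt (y.1 ^ 2 + y.2 ^ 2) ^ 2 = y.1 ^ 2 + y.2 ^ 2 := Real.sq_sqrt (by positivity)
    refine le_trans ?_ (sum_cosDefect_of_small hn1 t ?_)
    · rw [← hr]
      have h1 : n * (c₁ * (n : ℝ) ^ (5 * τ - 1 / 2)) ^ 2
          ≤ n * Real.sqrt (y.1 ^ 2 + y.2 ^ 2) ^ 2 := by gcongr
      refine le_trans ?_ h1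
      have e : n * (c₁ * (n : ℝ) ^ (5 * τ - 1 / 2)) ^ 2 = c₁ ^ 2 * Z ^ 20 := by
        have e1 : (n : ℝ) * ((n : ℝ) ^ (5 * τ - 1 / 2)) ^ 2 = Z ^ 20 := by
          rw [hZpow, ← Real.rpow_natCast, ← Real.rpow_mul hnpos.le]
          nth_rewrite 1 [← Real.rpow_one (n : ℝ)]
          rw [← Real.rpow_add hnpos]
          congr 1
          push_cast
          ring
        rw [← e1]; ring
      rw [e]
      have hT1 : T ≤ c₁ ^ 2 * Z ^ 18 := by
        have h2 : T / c₁ ^ 2 ≤ Z ^ 18 :=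
          le_trans (by linarith) (le_self_pow₀ (by linarith) (by norm_num))
        rw [div_le_iff₀ (by positivity)] at h2
        linarith
      have h3 : T * Z ^ 2 ≤ c₁ ^ 2 * Z ^ 18 * Z ^ 2 := by gcongr
      refine h3.trans_eq ?_
      ring
    · rw [← hr]
      have := Real.sqrt_nonneg (y.1 ^ 2 + y.2 ^ 2)
      nlinarith
  · refine sum_cosDefect_of_large hR0 hK hT hc₂ (Real.one_le_rpow hnr (by linarith)) (by linarith)
      (by linarith) (by linarith) hnYZ ?_ ?_ hy2 (not_le.mp hy)
    · rw [hZpow]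
      conv_lhs => rw [← Real.rpow_one (n : ℝ)]
      apply Real.rpow_le_rpow_of_exponent_le hnr
      rw [div_le_iff₀ hτ] at hR
      linarith
    · intro k hk0 hkK l
      have h1 := ht k (by exact_mod_cast hk0.ne') (by
        rw [Int.cast_natCast, Nat.abs_cast]
        exact le_trans (by exact_mod_cast hkK) hC) l
      have e : (n : ℝ) ^ (-1 + 8 * τ) = 1 / Y := by
        rw [hYdef, one_div, ← Real.rpow_neg hnpos.le]
        congr 1
        ring
      rw [e] at h1
      exact_mod_cast h1

theorem norm_sq_charIntegral (μ : Measure ℝ) [IsProbabilityMeasure μ] (θ : ℝ) :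
    ‖∫ s, Complex.exp (Complex.I * (s : ℂ) * (θ : ℂ)) ∂μ‖ ^ 2
      = ∫ p : ℝ × ℝ, Real.cos (θ * (p.1 - p.2)) ∂(μ.prod μ) := by
  have h1 : ((‖∫ s, Complex.exp (Complex.I * (s : ℂ) * (θ : ℂ)) ∂μ‖ ^ 2 : ℝ) : ℂ)
      = ∫ p : ℝ × ℝ, Complex.exp (((θ * (p.1 - p.2) : ℝ) : ℂ) * Complex.I) ∂(μ.prod μ) := by
    push_cast
    rw [← Complex.mul_conj', ← integral_conj, ← integral_prod_mul]
    congr 1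
    ext p
    rw [← Complex.exp_conj, ← Complex.exp_add]
    congr 1
    simp only [map_mul, Complex.conj_I, Complex.conj_ofReal]
    ring
  have hint : Integrable
      (fun p : ℝ × ℝ => Complex.exp (((θ * (p.1 - p.2) : ℝ) : ℂ) * Complex.I)) (μ.prod μ) :=
    Integrable.of_bound (Continuous.aestronglyMeasurable (by fun_prop)) 1
      (Filter.Eventually.of_forall fun p => (Complex.norm_exp_ofReal_mul_I _).le)
  have h2 := congrArg Complex.re h1
  rw [Complex.ofReal_re] at h2
  rw [h2, ← Complex.reCLM_apply, ← Complex.reCLM.integral_comp_comm hint]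
  simp only [Complex.reCLM_apply, Complex.exp_ofReal_mul_I_re]

theorem integrable_one_sub_cos (ν : Measure (ℝ × ℝ)) [IsFiniteMeasure ν] (θ : ℝ) :
    Integrable (fun p : ℝ × ℝ => 1 - Real.cos (θ * (p.1 - p.2))) ν := by
  refine Integrable.of_bound (Continuous.aestronglyMeasurable (by fun_prop)) 2
    (Filter.Eventually.of_forall fun p => ?_)
  have h1 := Real.cos_le_one (θ * (p.1 - p.2))
  have h2 := Real.neg_one_le_cos (θ * (p.1 - p.2))
  rw [Real.norm_eq_abs, abs_le]
  constructor <;> linarith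

theorem norm_charIntegral_le (μ : Measure ℝ) [IsProbabilityMeasure μ] (θ : ℝ) (G : Set (ℝ × ℝ)) :
    ‖∫ s, Complex.exp (Complex.I * (s : ℂ) * (θ : ℂ)) ∂μ‖
      ≤ Real.exp (-(1 / 2 * ∫ p in G, (1 - Real.cos (θ * (p.1 - p.2))) ∂(μ.prod μ))) := by
  set J := ∫ p in G, (1 - Real.cos (θ * (p.1 - p.2))) ∂(μ.prod μ) with hJ
  have h1 : J ≤ ∫ p : ℝ × ℝ, (1 - Real.cos (θ * (p.1 - p.2))) ∂(μ.prod μ) :=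
    setIntegral_le_integral (integrable_one_sub_cos _ θ)
      (Filter.Eventually.of_forall fun p => sub_nonneg.mpr (Real.cos_le_one _))
  have hcos : Integrable (fun p : ℝ × ℝ => Real.cos (θ * (p.1 - p.2))) (μ.prod μ) := by
    have h := (integrable_const (1 : ℝ)).sub (integrable_one_sub_cos (μ.prod μ) θ)
    exact h.congr (Filter.Eventually.of_forall fun p => sub_sub_cancel _ _)
  rw [integral_sub (integrable_const _) hcos, ← norm_sq_charIntegral] at h1
  simp only [integral_const, probReal_univ, smul_eq_mul, one_mul] at h1
  have h2 := Real.add_one_le_exp (-J)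
  have h3 : Real.exp (-(1 / 2 * J)) ^ 2 = Real.exp (-J) := by
    rw [← Real.exp_nat_mul]
    congr 1
    ring
  refine le_of_sq_le_sq (b := Real.exp (-(1 / 2 * J))) ?_ (Real.exp_pos _).le
  rw [h3]
  linarith

theorem exists_pos_measure_shell (μ : Measure ℝ) [IsProbabilityMeasure μ]
    (hmean : (∫ s, s ∂μ) = 0) (hvar : (∫ s, s ^ 2 ∂μ) = 1) :
    ∃ M : ℕ, 0 < (μ.prod μ).real
      {p : ℝ × ℝ | 1 / ((M : ℝ) + 1) ≤ |p.1 - p.2| ∧ |p.1 - p.2| ≤ (M : ℝ) + 1} := by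
  by_contra! hcon
  have hzero : ∀ M : ℕ, (μ.prod μ)
      {p : ℝ × ℝ | 1 / ((M : ℝ) + 1) ≤ |p.1 - p.2| ∧ |p.1 - p.2| ≤ (M : ℝ) + 1} = 0 := fun M =>
    (measureReal_eq_zero_iff).mp (le_antisymm (hcon M) measureReal_nonneg)
  have hdiag : ∀ᵐ p ∂(μ.prod μ), p.1 = p.2 := by
    have h := measure_iUnion_null hzero
    refine measure_mono_null (fun p hp => ?_) h
    have hp : p.1 - p.2 ≠ 0 := sub_ne_zero.mpr hp
    have hpos : 0 < |p.1 - p.2| := abs_pos.mpr hp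
    obtain ⟨M₁, h₁⟩ := exists_nat_one_div_lt hpos
    obtain ⟨M₂, h₂⟩ := exists_nat_ge |p.1 - p.2|
    refine Set.mem_iUnion.mpr ⟨max M₁ M₂, ?_, ?_⟩
    · refine le_trans ?_ h₁.le
      gcongr
      exact le_max_left _ _
    · have : (M₂ : ℝ) ≤ (max M₁ M₂ : ℕ) := by exact_mod_cast le_max_right _ _
      linarith
  obtain ⟨s₀, hs₀⟩ := (Measure.ae_ae_of_ae_prod hdiag).exists
  have e1 : ∫ s, s ∂μ = s₀ := by
    rw [integral_congr_ae (g := fun _ => s₀) (hs₀.mono fun s hs => hs.symm)]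
    simp
  have e2 : ∫ s, s ^ 2 ∂μ = s₀ ^ 2 := by
    rw [integral_congr_ae (g := fun _ => s₀ ^ 2)
      (hs₀.mono fun s hs => by simp only at hs ⊢; rw [hs])]
    simp
  rw [← e1, hmean] at e2
  rw [hvar] at e2
  norm_num at e2

theorem sum_one_sub_cos_eq (n : ℕ) (t u : ℝ) (x : ℝ × ℝ) :
    ∑ j ∈ Finset.Icc 1 n, ((1 - Real.cos (ipv n t j x * u)) + (1 - Real.cos (ipv' n t j x * u)))
      = ∑ j ∈ Finset.Icc 1 n,
          cosDefect n t (u / (2 * Real.pi) * x.1, u / (2 * Real.pi) * x.2) j := by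
  refine Finset.sum_congr rfl fun j _ => ?_
  have hpi := Real.pi_ne_zero
  have e1 : ipv n t j x * u
      = 2 * Real.pi * ipv n t j (u / (2 * Real.pi) * x.1, u / (2 * Real.pi) * x.2) := by
    simp only [ipv]; field_simp
  have e2 : ipv' n t j x * u
      = 2 * Real.pi * ipv' n t j (u / (2 * Real.pi) * x.1, u / (2 * Real.pi) * x.2) := by
    simp only [ipv']; field_simp
  rw [cosDefect, e1, e2]

theorem prod_norm_charIntegral_le {μ : Measure ℝ} [IsProbabilityMeasure μ] {G : Set (ℝ × ℝ)}
    (hG : MeasurableSet G) {n : ℕ} {t D : ℝ} {x : ℝ × ℝ}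
    (hD : ∀ p ∈ G, D ≤ ∑ j ∈ Finset.Icc 1 n,
      ((1 - Real.cos (ipv n t j x * (p.1 - p.2))) + (1 - Real.cos (ipv' n t j x * (p.1 - p.2))))) :
    ∏ i ∈ Finset.Icc 1 n,
        (‖∫ s, Complex.exp (Complex.I * (s : ℂ) * ((ipv n t i x : ℝ) : ℂ)) ∂μ‖ *
         ‖∫ s, Complex.exp (Complex.I * (s : ℂ) * ((ipv' n t i x : ℝ) : ℂ)) ∂μ‖)
      ≤ Real.exp (-(1 / 2 * ((μ.prod μ).real G * D))) := by
  set ν := (μ.prod μ).restrict G with hν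
  have hint : ∀ j ∈ Finset.Icc 1 n, Integrable (fun p : ℝ × ℝ =>
      (1 - Real.cos (ipv n t j x * (p.1 - p.2))) + (1 - Real.cos (ipv' n t j x * (p.1 - p.2)))) ν :=
    fun j _ => (integrable_one_sub_cos ν _).add (integrable_one_sub_cos ν _)
  calc _ ≤ ∏ i ∈ Finset.Icc 1 n, Real.exp (-(1 / 2 * ∫ p, ((1 - Real.cos (ipv n t i x *
            (p.1 - p.2))) + (1 - Real.cos (ipv' n t i x * (p.1 - p.2)))) ∂ν)) := by
        refine Finset.prod_le_prod (fun i _ => by positivity) fun i _ => ?_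
        rw [integral_add (integrable_one_sub_cos ν _) (integrable_one_sub_cos ν _), mul_add,
          neg_add, Real.exp_add]
        gcongr
        · exact norm_charIntegral_le μ _ G
        · exact norm_charIntegral_le μ _ G
    _ = Real.exp (-(1 / 2 * ∫ p, ∑ i ∈ Finset.Icc 1 n, ((1 - Real.cos (ipv n t i x *
            (p.1 - p.2))) + (1 - Real.cos (ipv' n t i x * (p.1 - p.2)))) ∂ν)) := by
        rw [integral_finsetSum _ hint, Finset.mul_sum, ← Finset.sum_neg_distrib, Real.exp_sum]
    _ ≤ _ := by
        have h := setIntegral_mono_on (integrable_const D).integrableOn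
          (integrable_finsetSum _ hint) hG hD
        rw [setIntegral_const, smul_eq_mul] at h
        gcongr

theorem stmt11 (μ : Measure ℝ) [IsProbabilityMeasure μ]
    (hmean : (∫ s, s ∂μ) = 0) (hvar : (∫ s, s ^ 2 ∂μ) = 1)
    (τ : ℝ) (hτ : 0 < τ) (hτ' : τ ≤ 1 / 64) :
    ∃ C₀'₀ : ℝ, ∀ C₀' ≥ C₀'₀, ∃ n₀ : ℕ, ∀ n : ℕ, n₀ ≤ n →
      ∀ t ∈ Set.Icc (-Real.pi) Real.pi, Condition n τ C₀' t →
      ∀ x : ℝ × ℝ,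
        (n : ℝ) ^ (5 * τ - 1 / 2) ≤ Real.sqrt (x.1 ^ 2 + x.2 ^ 2) →
        Real.sqrt (x.1 ^ 2 + x.2 ^ 2) ≤ (n : ℝ) ^ (1 - 8 * τ) →
        ∏ i ∈ Finset.Icc 1 n,
            (‖∫ s, Complex.exp (Complex.I * (s : ℂ) * ((ipv n t i x : ℝ) : ℂ)) ∂μ‖ *
             ‖∫ s, Complex.exp (Complex.I * (s : ℂ) * ((ipv' n t i x : ℝ) : ℂ)) ∂μ‖)
          ≤ Real.exp (-(n : ℝ) ^ τ) := by
  obtain ⟨M, hM⟩ := exists_pos_measure_shell μ hmean hvar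
  set G := {p : ℝ × ℝ | 1 / ((M : ℝ) + 1) ≤ |p.1 - p.2| ∧ |p.1 - p.2| ≤ (M : ℝ) + 1} with hGdef
  set g := (μ.prod μ).real G with hg
  have hG : MeasurableSet G := by
    have hc : Continuous fun p : ℝ × ℝ => |p.1 - p.2| := by fun_prop
    exact ((isClosed_le continuous_const hc).inter (isClosed_le hc continuous_const)).measurableSet
  have hpi := Real.pi_pos
  obtain ⟨K, n₀, hK⟩ := exists_sum_cosDefect_lower_bound (τ := τ)
    (c₁ := 1 / ((M : ℝ) + 1) / (2 * Real.pi)) (c₂ := ((M : ℝ) + 1) / (2 * Real.pi)) (T := 2 / g)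
    hτ (by linarith) (by positivity) (by positivity) (by positivity)
  refine ⟨K, fun C₀' hC => ⟨n₀, fun n hn t _ ht x hx1 hx2 => ?_⟩⟩
  refine (prod_norm_charIntegral_le (D := 2 / g * (n : ℝ) ^ τ) hG fun p hp => ?_).trans_eq ?_
  · rw [sum_one_sub_cos_eq]
    have e : Real.sqrt (((p.1 - p.2) / (2 * Real.pi) * x.1) ^ 2
        + ((p.1 - p.2) / (2 * Real.pi) * x.2) ^ 2)
        = |p.1 - p.2| / (2 * Real.pi) * Real.sqrt (x.1 ^ 2 + x.2 ^ 2) := by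
      rw [mul_pow, mul_pow, ← mul_add, Real.sqrt_mul (sq_nonneg _), Real.sqrt_sq_eq_abs, abs_div,
        abs_of_pos Real.two_pi_pos]
    refine hK n hn t C₀' hC ht _ ?_ ?_
    · rw [e]
      have h1 := hp.1
      gcongr
    · rw [e]
      have h2 := hp.2
      gcongr
  · rw [← hg]
    congr 1
    field_simp
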